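/- For every integer n ≥ 2, the finite left absorption probabilities of the three-state Grover walk started at position 1 in internal state R satisfy the linear fractional recurrence P_{n+1}^{(1)}(1,0,0) = (2 + 3·P_n^{(1)}(1,0,0))/(3 + 4·P_n^{(1)}(1,0,0)). -/

import Mathlib

open scoped Classical
open Filter Topology

/-- Step value of a three-state internal state: `0` = R ↦ +1, `1` = S ↦ 0, `2` = L ↦ −1. -/
def gstep (σ : Fin 3) : ℤ := 1 - (σ : ℤ)

/-- Step amplitudes of the three-state Grover walk: `A(σ→σ) = −1/3`, `A(σ→σ') = 2/3` for σ ≠ σ'. -/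
noncomputable def gamp (σ σ' : Fin 3) : ℝ := if σ = σ' then -1/3 else 2/3

/-- Amplitude `A(γ) = Π_{k=1}^t A(σ_{k−1}→σ_k)` of a `t`-path `γ = (σ_0, …, σ_t)`. -/
noncomputable def gpamp {t : ℕ} (γ : Fin (t + 1) → Fin 3) : ℝ :=
  ∏ k : Fin t, gamp (γ k.castSucc) (γ k.succ)

/-- Partial displacement `S_k(γ) = σ_1 + ⋯ + σ_k` of a `t`-path `γ = (σ_0, …, σ_t)`. -/
def gS {t : ℕ} (γ : Fin (t + 1) → Fin 3) (k : ℕ) : ℤ :=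
  ∑ i ∈ Finset.univ.filter (fun i : Fin t => (i : ℕ) < k), gstep (γ i.succ)

/-- `c_t` for the semi-infinite walk: sum of `A(γ)` over `t`-paths with `σ_0 = R`, `σ_t = L`,
`S_t(γ) = −m`, and `S_k(γ) > −m` for all `k < t`. -/
noncomputable def gcInf (m : ℕ) (t : ℕ) : ℝ :=
  ∑ γ ∈ Finset.univ.filter (fun γ : Fin (t + 1) → Fin 3 =>
      γ 0 = 0 ∧ γ (Fin.last t) = 2 ∧ gS γ t = -(m : ℤ) ∧
      ∀ k < t, -(m : ℤ) < gS γ k),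
    gpamp γ

/-- `c_t` for the finite walk: sum of `A(γ)` over `t`-paths with `σ_0 = R`, `σ_t = L`,
`S_t(γ) = −m`, and `−m < S_k(γ) < n − m` for all `k < t`. -/
noncomputable def gcFin (n m : ℕ) (t : ℕ) : ℝ :=
  ∑ γ ∈ Finset.univ.filter (fun γ : Fin (t + 1) → Fin 3 =>
      γ 0 = 0 ∧ γ (Fin.last t) = 2 ∧ gS γ t = -(m : ℤ) ∧
      ∀ k < t, -(m : ℤ) < gS γ k ∧ gS γ k < (n : ℤ) - (m : ℤ)),
    gpamp γ

/-- Semi-infinite left absorption probability `P_∞^{(m)}(1,0,0)` of the Grover walk. -/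
noncomputable def GPinf (m : ℕ) : ℝ := ∑' t : ℕ, (gcInf m t) ^ 2

/-- Finite left absorption probability `P_n^{(m)}(1,0,0)` of the Grover walk. -/
noncomputable def GPfin (n m : ℕ) : ℝ := ∑' t : ℕ, (gcFin n m t) ^ 2

/-- Path sum with arbitrary initial state `σ` and integer starting position `m`. -/
noncomputable def gW (n : ℤ) (t : ℕ) (m : ℤ) (σ : Fin 3) : ℝ :=
  ∑ γ ∈ Finset.univ.filter (fun γ : Fin (t + 1) → Fin 3 =>
      γ 0 = σ ∧ γ (Fin.last t) = 2 ∧ gS γ t = -m ∧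
      ∀ k < t, -m < gS γ k ∧ gS γ k < n - m),
    gpamp γ

theorem gcFin_eq_gW (n m t : ℕ) : gcFin n m t = gW n t m 0 := rfl

theorem gS_zero {t : ℕ} (γ : Fin (t + 1) → Fin 3) : gS γ 0 = 0 := by
  simp [gS]

theorem gS_cons {t : ℕ} (σ : Fin 3) (γ : Fin (t + 1) → Fin 3) (k : ℕ) :
    gS (Fin.cons σ γ : Fin (t + 2) → Fin 3) (k + 1) = gstep (γ 0) + gS γ k := by
  simp [gS, Finset.sum_filter, Fin.sum_univ_succ]

theorem gpamp_cons {t : ℕ} (σ : Fin 3) (γ : Fin (t + 1) → Fin 3) :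
    gpamp (Fin.cons σ γ : Fin (t + 2) → Fin 3) = gamp σ (γ 0) * gpamp γ := by
  simp [gpamp, Fin.prod_univ_succ]

theorem gW_zero (n m : ℤ) (σ : Fin 3) :
    gW n 0 m σ = if σ = 2 ∧ m = 0 then 1 else 0 := by
  have h : ∀ γ : Fin (0 + 1) → Fin 3,
      (γ 0 = σ ∧ γ (Fin.last 0) = 2 ∧ gS γ 0 = -m ∧
        ∀ k < 0, -m < gS γ k ∧ gS γ k < n - m) ↔ (γ = fun _ => σ) ∧ (σ = 2 ∧ m = 0) := by
    intro γ
    rw [gS_zero, funext_iff]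
    simp only [Fin.forall_fin_one, Nat.reduceAdd]
    constructor
    · rintro ⟨h1, h2, h3, -⟩
      exact ⟨h1, h1 ▸ h2, by omega⟩
    · rintro ⟨h1, h2, h3⟩
      exact ⟨h1, h1.trans h2, by omega, fun k hk => absurd hk (by omega)⟩
  rw [gW, Finset.sum_filter]
  simp only [h]
  by_cases hc : σ = 2 ∧ m = 0
  · simp only [hc, and_self, and_true, if_true]
    rw [Finset.sum_ite_eq' Finset.univ (fun _ : Fin (0 + 1) => (2 : Fin 3)) gpamp]
    simp [gpamp]
  · simp [hc]

theorem gW_succ (n : ℤ) (t : ℕ) (m : ℤ) (σ : Fin 3) :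
    gW n (t + 1) m σ = if 0 < m ∧ m < n then
      ∑ σ', gamp σ σ' * gW n t (m + gstep σ') σ' else 0 := by
  have key : ∀ (σ₀ : Fin 3) (γ : Fin (t + 1) → Fin 3),
      ((Fin.cons σ₀ γ : Fin (t + 2) → Fin 3) 0 = σ ∧
        (Fin.cons σ₀ γ : Fin (t + 2) → Fin 3) (Fin.last (t + 1)) = 2 ∧
        gS (Fin.cons σ₀ γ : Fin (t + 2) → Fin 3) (t + 1) = -m ∧
        ∀ k < t + 1, -m < gS (Fin.cons σ₀ γ : Fin (t + 2) → Fin 3) k ∧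
          gS (Fin.cons σ₀ γ : Fin (t + 2) → Fin 3) k < n - m) ↔
      (σ₀ = σ ∧ (0 < m ∧ m < n) ∧ γ (Fin.last t) = 2 ∧ gS γ t = -(m + gstep (γ 0)) ∧
        ∀ k < t, -(m + gstep (γ 0)) < gS γ k ∧ gS γ k < n - (m + gstep (γ 0))) := by
    intro σ₀ γ
    rw [gS_cons, ← Fin.succ_last, Fin.cons_succ, Fin.cons_zero]
    constructor
    · rintro ⟨h1, h2, h3, h4⟩
      have h0 := h4 0 (by omega)
      rw [gS_zero] at h0
      refine ⟨h1, by omega, h2, by omega, fun k hk => ?_⟩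
      have := h4 (k + 1) (by omega)
      rw [gS_cons] at this
      omega
    · rintro ⟨h1, h0, h2, h3, h4⟩
      refine ⟨h1, h2, by omega, fun k hk => ?_⟩
      cases k with
      | zero => rw [gS_zero]; omega
      | succ k =>
        rw [gS_cons]
        have := h4 k (by omega)
        omega
  rw [gW, Finset.sum_filter,
    ← (Fin.consEquiv (fun _ : Fin (t + 2) => Fin 3)).sum_comp, Fintype.sum_prod_type]
  simp only [Fin.consEquiv, Equiv.coe_fn_mk, key, gpamp_cons]
  by_cases hm : 0 < m ∧ m < n
  · simp only [hm, and_self, true_and, if_true]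
    rw [Finset.sum_eq_single σ (fun b _ hb => by simp [hb]) (by simp)]
    simp only [gW, Finset.sum_filter, Finset.mul_sum, true_and]
    rw [Finset.sum_comm]
    refine Finset.sum_congr rfl fun γ _ => ?_
    rw [Finset.sum_eq_single (γ 0) (fun b _ hb => by simp [hb.symm]) (by simp)]
    simp
  · simp [hm]

/-- The polynomials `E_k` with `E_0 = 0`, `E_1 = 1` and
`E_{k+2} = (3z² + 4z + 3) E_{k+1} - z² E_k`: up to a power of `-z`, the Chebyshev polynomials
of the second kind at `-2 - 3(z + z⁻¹)/2`. -/
def gE {R : Type*} [CommRing R] (z : R) : ℕ → R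
  | 0 => 0
  | 1 => 1
  | k + 2 => (3 * z ^ 2 + 4 * z + 3) * gE z (k + 1) - z ^ 2 * gE z k

/-- Numerator of the reflection amplitude of `k` sites. -/
def gNum {R : Type*} [CommRing R] (z : R) (k : ℕ) : R := 2 * z * (1 + z) * gE z k

/-- Denominator of the reflection amplitude of `k` sites. -/
def gDen {R : Type*} [CommRing R] (z : R) (k : ℕ) : R :=
  z ^ 2 * (3 * z + 1) * gE z k + (1 - z) * gE z (k + 1)

theorem gE_add_two {R : Type*} [CommRing R] (z : R) (k : ℕ) :
    gE z (k + 2) = (3 * z ^ 2 + 4 * z + 3) * gE z (k + 1) - z ^ 2 * gE z k := rfl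

theorem map_gE {R S : Type*} [CommRing R] [CommRing S] (φ : R →+* S) (z : R) (k : ℕ) :
    φ (gE z k) = gE (φ z) k := by
  induction k using gE.induct with
  | case1 => simp [gE]
  | case2 => simp [gE]
  | case3 k h1 h2 => simp [gE_add_two, h1, h2, map_ofNat φ]

theorem map_gNum {R S : Type*} [CommRing R] [CommRing S] (φ : R →+* S) (z : R) (k : ℕ) :
    φ (gNum z k) = gNum (φ z) k := by
  simp [gNum, map_gE, map_ofNat φ]

theorem map_gDen {R S : Type*} [CommRing R] [CommRing S] (φ : R →+* S) (z : R) (k : ℕ) :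
    φ (gDen z k) = gDen (φ z) k := by
  simp [gDen, map_gE, map_ofNat φ]

theorem one_sub_mul_gDen_succ {R : Type*} [CommRing R] (z : R) (k : ℕ) :
    (1 - z) * gDen z (k + 1) = (3 + z) * gDen z k - 2 * z * (1 + z) * gNum z k := by
  simp only [gDen, gNum, gE_add_two]; ring

theorem one_sub_mul_gNum_succ {R : Type*} [CommRing R] (z : R) (k : ℕ) :
    (1 - z) * gNum z (k + 1) = 2 * z * (1 + z) * gDen z k - z ^ 2 * (1 + 3 * z) * gNum z k := by
  simp only [gDen, gNum]; ring

theorem three_add_mul_gNum_succ {R : Type*} [CommRing R] (z : R) (k : ℕ) :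
    (3 + z) * gNum z (k + 1) =
      2 * z * (1 + z) * gDen z (k + 1) - z ^ 2 * (z - 1) * gNum z k := by
  simp only [gDen, gNum, gE_add_two]; ring

/-- Generating series of the path sums `gW`. -/
noncomputable def gGen (n m : ℤ) (σ : Fin 3) : PowerSeries ℂ :=
  PowerSeries.mk fun t => ((gW n t m σ : ℝ) : ℂ)

theorem gGen_boundary {n m : ℤ} (h : ¬(0 < m ∧ m < n)) (σ : Fin 3) :
    gGen n m σ = if σ = 2 ∧ m = 0 then 1 else 0 := by
  ext t
  cases t with
  | zero => split_ifs with hc <;> simp [gGen, gW_zero, hc]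
  | succ t => split_ifs with hc <;> simp [gGen, gW_succ, h, PowerSeries.coeff_one]

theorem gGen_interior {n m : ℤ} (h : 0 < m ∧ m < n) (σ : Fin 3) :
    gGen n m σ = PowerSeries.X *
      ∑ σ', PowerSeries.C ((gamp σ σ' : ℝ) : ℂ) * gGen n (m + gstep σ') σ' := by
  ext t
  cases t with
  | zero =>
    have : ¬(σ = 2 ∧ m = 0) := by omega
    simp [gGen, gW_zero, this]
  | succ t =>
    rw [PowerSeries.coeff_succ_X_mul]
    simp [gGen, gW_succ, h]

theorem gGen_scattering {n m : ℤ} (h : 0 < m ∧ m < n) :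
    (3 + PowerSeries.X) * gGen n m 0 =
        2 * PowerSeries.X * (1 + PowerSeries.X) * gGen n (m - 1) 2 +
          PowerSeries.X * (PowerSeries.X - 1) * gGen n (m + 1) 0 ∧
      (3 + PowerSeries.X) * gGen n m 2 =
        PowerSeries.X * (PowerSeries.X - 1) * gGen n (m - 1) 2 +
          2 * PowerSeries.X * (1 + PowerSeries.X) * gGen n (m + 1) 0 := by
  have h0 := gGen_interior h 0
  have h1 := gGen_interior h 1
  have h2 := gGen_interior h 2
  have e0 : m + gstep 0 = m + 1 := by simp [gstep]
  have e1 : m + gstep 1 = m := by simp [gstep]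
  have e2 : m + gstep 2 = m - 1 := by simp [gstep]; ring
  have hs : (3 : PowerSeries ℂ) * PowerSeries.C (((-1 / 3 : ℝ)) : ℂ) = -1 := by
    have : (3 : PowerSeries ℂ) = PowerSeries.C 3 := (map_ofNat _ 3).symm
    rw [this, ← map_mul]; norm_num
  have hd : (3 : PowerSeries ℂ) * PowerSeries.C (((2 / 3 : ℝ)) : ℂ) = 2 := by
    have : (3 : PowerSeries ℂ) = PowerSeries.C 3 := (map_ofNat _ 3).symm
    rw [this, ← map_mul]; norm_num; exact map_ofNat _ 2
  have n3 : (3 : PowerSeries ℂ) ≠ 0 := by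
    intro h
    have := congrArg (PowerSeries.constantCoeff (R := ℂ)) h
    simp [map_ofNat PowerSeries.constantCoeff] at this
  simp only [Fin.sum_univ_three, e0, e1, e2, gamp] at h0 h1 h2
  simp only [Fin.isValue, reduceIte, Fin.reduceEq] at h0 h1 h2
  generalize PowerSeries.C (((-1 / 3 : ℝ)) : ℂ) = a at *
  generalize PowerSeries.C (((2 / 3 : ℝ)) : ℂ) = b at *
  generalize (PowerSeries.X : PowerSeries ℂ) = X at *
  generalize gGen n m 0 = r at *
  generalize gGen n m 1 = s at *
  generalize gGen n m 2 = l at *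
  generalize gGen n (m + 1) 0 = r' at *
  generalize gGen n (m - 1) 2 = l' at *
  have k0 : 3 * r = X * (-r' + 2 * s + 2 * l') := by
    linear_combination 3 * h0 + X * r' * hs + X * s * hd + X * l' * hd
  have k1 : 3 * s = X * (2 * r' - s + 2 * l') := by
    linear_combination 3 * h1 + X * r' * hd + X * s * hs + X * l' * hd
  have k2 : 3 * l = X * (2 * r' + 2 * s - l') := by
    linear_combination 3 * h2 + X * r' * hd + X * s * hd + X * l' * hs
  constructor
  · apply mul_left_cancel₀ n3
    linear_combination (3 + X) * k0 + 2 * X * k1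
  · apply mul_left_cancel₀ n3
    linear_combination (3 + X) * k2 + 2 * X * k1

theorem gE_zero_left {R : Type*} [CommRing R] (k : ℕ) : gE (0 : R) (k + 1) = 3 ^ k := by
  induction k with
  | zero => simp [gE]
  | succ k ih => simp [gE_add_two, ih, pow_succ]; ring

theorem gDen_zero_left {R : Type*} [CommRing R] (k : ℕ) : gDen (0 : R) k = 3 ^ k := by
  simp [gDen, gE_zero_left]

theorem gDen_X_ne_zero (k : ℕ) : gDen (PowerSeries.X : PowerSeries ℂ) k ≠ 0 := by
  intro h
  have := congrArg (PowerSeries.constantCoeff (R := ℂ)) h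
  rw [map_gDen] at this
  simp [gDen_zero_left] at this

theorem gGen_mul_gDen {n : ℤ} (k : ℕ) (hk : k < n) :
    gGen n (n - k) 0 * gDen PowerSeries.X k =
      gNum PowerSeries.X k * gGen n (n - k - 1) 2 := by
  induction k with
  | zero => simp [gGen_boundary, gNum, gE]
  | succ k ih =>
    have ih := ih (by push_cast at hk; omega)
    obtain ⟨hr, hl⟩ := gGen_scattering (n := n) (m := n - (k + 1 : ℕ))
      (by push_cast at *; omega)
    have e : n - ((k + 1 : ℕ) : ℤ) + 1 = n - k := by push_cast; ring
    have e' : n - (k : ℤ) - 1 = n - ((k + 1 : ℕ) : ℤ) := by push_cast; ring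
    rw [e] at hr hl
    rw [e'] at ih
    have hD := gDen_X_ne_zero k
    have i1 := one_sub_mul_gDen_succ (PowerSeries.X : PowerSeries ℂ) k
    have i2 := three_add_mul_gNum_succ (PowerSeries.X : PowerSeries ℂ) k
    have n1 : (1 - PowerSeries.X : PowerSeries ℂ) ≠ 0 := by
      intro h
      have := congrArg (PowerSeries.constantCoeff (R := ℂ)) h
      simp at this
    have n3 : (3 + PowerSeries.X : PowerSeries ℂ) ≠ 0 := by
      intro h
      have := congrArg (PowerSeries.constantCoeff (R := ℂ)) h
      simp [map_ofNat PowerSeries.constantCoeff] at this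
    generalize (PowerSeries.X : PowerSeries ℂ) = X at *
    generalize gGen n (n - ((k + 1 : ℕ) : ℤ)) 0 = r at *
    generalize gGen n (n - ((k + 1 : ℕ) : ℤ)) 2 = l at *
    generalize gGen n (n - k) 0 = r' at *
    generalize gGen n (n - ((k + 1 : ℕ) : ℤ) - 1) 2 = l' at *
    have hl2 : l * gDen X (k + 1) = -X * gDen X k * l' := by
      apply mul_left_cancel₀ n1
      linear_combination l * i1 + gDen X k * hl + 2 * X * (1 + X) * ih
    apply mul_left_cancel₀ (mul_ne_zero n3 hD)
    linear_combination gDen X k * gDen X (k + 1) * hr + X * (X - 1) * gDen X (k + 1) * ih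
      + X * (X - 1) * gNum X k * hl2 - gDen X k * l' * i2

theorem summable_norm_coeff_of_mul_X_sub_C {F : PowerSeries ℂ} {a : ℂ} (ha : 1 < ‖a‖)
    (h : Summable fun t => ‖PowerSeries.coeff t (F * (PowerSeries.X - PowerSeries.C a))‖) :
    Summable fun t => ‖PowerSeries.coeff t F‖ := by
  set G := F * (PowerSeries.X - PowerSeries.C a) with hG
  have h0 : ‖a‖ * ‖PowerSeries.coeff 0 F‖ = ‖PowerSeries.coeff 0 G‖ := by
    rw [hG, mul_sub, map_sub, PowerSeries.coeff_mul_C]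
    simp [mul_comm]
  have hs : ∀ t, ‖a‖ * ‖PowerSeries.coeff (t + 1) F‖ ≤
      ‖PowerSeries.coeff t F‖ + ‖PowerSeries.coeff (t + 1) G‖ := by
    intro t
    have : a * PowerSeries.coeff (t + 1) F =
        PowerSeries.coeff t F - PowerSeries.coeff (t + 1) G := by
      rw [hG, mul_sub, map_sub, PowerSeries.coeff_mul_C, PowerSeries.coeff_succ_mul_X]
      ring
    rw [← norm_mul, this]
    exact norm_sub_le _ _
  have key : ∀ T, ‖a‖ * ∑ t ∈ Finset.range (T + 1), ‖PowerSeries.coeff t F‖ ≤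
      ∑ t ∈ Finset.range T, ‖PowerSeries.coeff t F‖ +
        ∑ t ∈ Finset.range (T + 1), ‖PowerSeries.coeff t G‖ := by
    intro T
    induction T with
    | zero => simp only [zero_add, Finset.sum_range_one, Finset.sum_range_zero, h0, le_refl]
    | succ T ih =>
      rw [Finset.sum_range_succ, mul_add, Finset.sum_range_succ _ T,
        Finset.sum_range_succ _ (T + 1)]
      rw [Finset.sum_range_succ _ T] at ih
      have := hs T
      linarith
  refine summable_of_sum_range_le (c := (∑' t, ‖PowerSeries.coeff t G‖) / (‖a‖ - 1))
    (fun _ => norm_nonneg _) fun T => ?_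
  rw [le_div_iff₀ (by linarith)]
  have h1 := key T
  have h2 := h.sum_le_tsum (Finset.range (T + 1)) (fun _ _ => norm_nonneg _)
  have h3 : ∑ t ∈ Finset.range T, ‖PowerSeries.coeff t F‖ ≤
      ∑ t ∈ Finset.range (T + 1), ‖PowerSeries.coeff t F‖ :=
    Finset.sum_le_sum_of_subset_of_nonneg (Finset.range_mono (by omega))
      fun _ _ _ => norm_nonneg _
  have h4 : ‖a‖ * ∑ t ∈ Finset.range T, ‖PowerSeries.coeff t F‖ ≤
      ‖a‖ * ∑ t ∈ Finset.range (T + 1), ‖PowerSeries.coeff t F‖ :=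
    mul_le_mul_of_nonneg_left h3 (norm_nonneg _)
  linarith

theorem summable_norm_coeff_polynomial (q : Polynomial ℂ) : Summable fun t => ‖q.coeff t‖ :=
  summable_of_ne_finset_zero (s := q.support) fun t ht => by
    simpa [Polynomial.mem_support_iff] using ht

/-- A power series that represents a rational function without poles in the closed unit disc
has summable coefficients. -/
theorem summable_norm_coeff_of_mul_polynomial {F : PowerSeries ℂ} {p q : Polynomial ℂ}
    (hp : ∀ z : ℂ, ‖z‖ ≤ 1 → p.eval z ≠ 0) (h : F * (p : PowerSeries ℂ) = q) :
    Summable fun t => ‖PowerSeries.coeff t F‖ := by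
  have hp0 : p ≠ 0 := by
    rintro rfl
    exact hp 0 (by simp) (by simp)
  have hroots : ∀ a ∈ p.roots, 1 < ‖a‖ := by
    intro a ha
    by_contra! hle
    exact hp a hle ((Polynomial.mem_roots hp0).1 ha)
  have gen : ∀ (s : Multiset ℂ) (F : PowerSeries ℂ), (∀ a ∈ s, 1 < ‖a‖) →
      (Summable fun t => ‖PowerSeries.coeff t (F *
        (((s.map fun a => Polynomial.X - Polynomial.C a).prod : Polynomial ℂ) :
          PowerSeries ℂ))‖) →
      Summable fun t => ‖PowerSeries.coeff t F‖ := by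
    intro s
    induction s using Multiset.induction with
    | empty => intro F _ h; simpa using h
    | cons a s ih =>
      intro F hs h
      refine summable_norm_coeff_of_mul_X_sub_C (hs a (by simp))
        (ih _ (fun b hb => hs b (by simp [hb])) ?_)
      rw [Multiset.map_cons, Multiset.prod_cons, Polynomial.coe_mul, Polynomial.coe_sub,
        Polynomial.coe_X, Polynomial.coe_C, ← mul_assoc] at h
      exact h
  have hlead : p.leadingCoeff ≠ 0 := Polynomial.leadingCoeff_ne_zero.2 hp0
  have hfac := (IsAlgClosed.splits p).eq_prod_roots
  refine gen p.roots F hroots ?_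
  have hprod : (p.roots.map fun a => Polynomial.X - Polynomial.C a).prod =
      p * Polynomial.C p.leadingCoeff⁻¹ := by
    apply mul_left_cancel₀ (Polynomial.C_ne_zero.2 hlead)
    rw [← hfac, mul_left_comm, ← Polynomial.C_mul, mul_inv_cancel₀ hlead, Polynomial.C_1, mul_one]
  rw [hprod, Polynomial.coe_mul, ← mul_assoc, h, ← Polynomial.coe_mul]
  simpa only [Polynomial.coeff_coe] using summable_norm_coeff_polynomial _

theorem tsum_coeff_mul_eval {F : PowerSeries ℂ} {p q : Polynomial ℂ}
    (hF : Summable fun t => ‖PowerSeries.coeff t F‖) (h : F * (p : PowerSeries ℂ) = q)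
    {z : ℂ} (hz : ‖z‖ ≤ 1) :
    (∑' t, PowerSeries.coeff t F * z ^ t) * p.eval z = q.eval z := by
  have heval : ∀ r : Polynomial ℂ, r.eval z = ∑' t, r.coeff t * z ^ t := by
    intro r
    rw [Polynomial.eval_eq_sum, Polynomial.sum_def,
      tsum_eq_sum (s := r.support) fun t ht => by
        rw [Polynomial.notMem_support_iff.1 ht, zero_mul]]
  have hsum : ∀ c : ℕ → ℂ, (Summable fun t => ‖c t‖) → Summable fun t => ‖c t * z ^ t‖ := by
    intro c hc
    refine hc.of_nonneg_of_le (fun _ => norm_nonneg _) fun t => ?_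
    rw [norm_mul, norm_pow]
    exact mul_le_of_le_one_right (norm_nonneg _) (pow_le_one₀ (norm_nonneg _) hz)
  rw [heval p, heval q, tsum_mul_tsum_eq_tsum_sum_antidiagonal_of_summable_norm (hsum _ hF)
    (hsum _ (summable_norm_coeff_polynomial p))]
  refine tsum_congr fun t => ?_
  rw [← Polynomial.coeff_coe, ← h, PowerSeries.coeff_mul, Finset.sum_mul]
  refine Finset.sum_congr rfl fun ij hij => ?_
  rw [← Finset.HasAntidiagonal.mem_antidiagonal.1 hij, Polynomial.coeff_coe, pow_add]
  ring

theorem norm_gNum_le_norm_gDen {z : ℂ} (hz : ‖z‖ ≤ 1) (k : ℕ) : ‖gNum z k‖ ≤ ‖gDen z k‖ := by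
  induction k with
  | zero => simp [gNum, gE]
  | succ k ih =>
    by_cases h1 : z = 1
    · subst h1
      refine le_of_eq (congrArg _ ?_)
      simp [gNum, gDen]; norm_num
    set u := gNum z k
    set d := gDen z k
    set α := (3 + z) * d - 2 * z * (1 + z) * u with hα
    set r := 2 * z * (1 + z) * d - z ^ 2 * (1 + 3 * z) * u with hr
    have h3 : (3 + z) ≠ 0 := by
      intro h
      have : z = -3 := by linear_combination h
      rw [this] at hz
      norm_num at hz
    have hsq : ‖z‖ ^ 2 ≤ 1 := by nlinarith [norm_nonneg z]
    have hblaschke : ‖1 + 3 * z‖ ≤ ‖3 + z‖ := by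
      rw [← sq_le_sq₀ (norm_nonneg _) (norm_nonneg _), ← Complex.normSq_eq_norm_sq,
        ← Complex.normSq_eq_norm_sq]
      rw [← Complex.normSq_eq_norm_sq] at hsq
      simp only [Complex.normSq_apply, Complex.add_re, Complex.add_im, Complex.mul_re,
        Complex.mul_im, Complex.one_re, Complex.one_im, Complex.re_ofNat, Complex.im_ofNat]
        at hsq ⊢
      nlinarith
    have hplus : ‖r + z * (z - 1) * d‖ ≤ ‖α + z * (z - 1) * u‖ := by
      have e : (3 + z) * (r + z * (z - 1) * d) =
          z * (1 + 3 * z) * (α + z * (z - 1) * u) := by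
        rw [hr, hα]; ring
      refine le_of_mul_le_mul_left ?_ (norm_pos_iff.2 h3)
      rw [← norm_mul, e, norm_mul, norm_mul]
      refine mul_le_mul_of_nonneg_right ?_ (norm_nonneg _)
      nlinarith [norm_nonneg z, norm_nonneg (1 + 3 * z)]
    have hminus : ‖r - z * (z - 1) * d‖ ≤ ‖α - z * (z - 1) * u‖ := by
      have e : r - z * (z - 1) * d = z * (α - z * (z - 1) * u) := by
        rw [hr, hα]; ring
      rw [e, norm_mul]
      exact mul_le_of_le_one_left (norm_nonneg _) hz
    have hmid : ‖z * (z - 1) * u‖ ≤ ‖z * (z - 1) * d‖ := by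
      rw [norm_mul, norm_mul _ d]
      exact mul_le_mul_of_nonneg_left ih (norm_nonneg _)
    have p1 := parallelogram_law_with_norm ℝ r (z * (z - 1) * d)
    have p2 := parallelogram_law_with_norm ℝ α (z * (z - 1) * u)
    have hle : ‖r‖ ≤ ‖α‖ := by
      rw [← sq_le_sq₀ (norm_nonneg _) (norm_nonneg _)]
      have q1 := mul_self_le_mul_self (norm_nonneg _) hplus
      have q2 := mul_self_le_mul_self (norm_nonneg _) hminus
      have q3 := mul_self_le_mul_self (norm_nonneg _) hmid
      nlinarith
    have hne : (1 - z) ≠ 0 := sub_ne_zero.2 (Ne.symm h1)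
    refine le_of_mul_le_mul_left ?_ (norm_pos_iff.2 hne)
    rw [← norm_mul, ← norm_mul, one_sub_mul_gDen_succ, one_sub_mul_gNum_succ]
    exact hle

theorem gE_succ_ne_zero {z : ℂ} (hz : z ≠ 0) (k : ℕ) (h : gE z k = 0) : gE z (k + 1) ≠ 0 := by
  induction k with
  | zero => simp [gE]
  | succ k ih =>
    intro h'
    rw [gE_add_two, h] at h'
    have h0 : gE z k = 0 := by simpa [hz] using h'
    exact ih h0 h

theorem gE_one_ne_zero (k : ℕ) : gE (1 : ℂ) (k + 1) ≠ 0 := by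
  have : ‖gE (1 : ℂ) k‖ ≤ ‖gE (1 : ℂ) (k + 1)‖ ∧ 0 < ‖gE (1 : ℂ) (k + 1)‖ := by
    induction k with
    | zero => simp [gE]
    | succ k ih =>
      have e : 10 * gE (1 : ℂ) (k + 1) = gE 1 (k + 2) + gE 1 k := by
        rw [gE_add_two]; ring
      have := norm_add_le (gE (1 : ℂ) (k + 2)) (gE 1 k)
      rw [← e, norm_mul] at this
      norm_num at this
      constructor <;> linarith [ih.1, ih.2]
  exact norm_pos_iff.1 this.2

theorem gE_neg_one (k : ℕ) : gE (-1 : ℂ) k = k := by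
  induction k using gE.induct with
  | case1 => simp [gE]
  | case2 => simp [gE]
  | case3 k h1 h2 => rw [gE_add_two, h1, h2]; push_cast; ring

theorem gDen_ne_zero {z : ℂ} (hz : ‖z‖ ≤ 1) (k : ℕ) : gDen z (k + 1) ≠ 0 := by
  intro h
  have hN : gNum z (k + 1) = 0 := by
    have := norm_gNum_le_norm_gDen hz (k + 1)
    rw [h, norm_zero] at this
    exact norm_le_zero_iff.1 this
  by_cases h0 : z = 0
  · rw [h0, gDen_zero_left] at h
    exact pow_ne_zero _ (by norm_num) h
  by_cases h1 : 1 + z = 0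
  · have : z = -1 := by linear_combination h1
    rw [gDen, this, gE_neg_one, gE_neg_one] at h
    push_cast at h
    have : (2 : ℂ) = 0 := by linear_combination h
    norm_num at this
  have hE : gE z (k + 1) = 0 := by simpa [gNum, h0, h1] using hN
  rw [gDen, hE, mul_zero, zero_add, mul_eq_zero] at h
  rcases h with h | h
  · have : z = 1 := by linear_combination -h
    rw [this] at hE
    exact gE_one_ne_zero k hE
  · exact gE_succ_ne_zero h0 _ hE h

theorem gE_mul_gE_succ_of_mul_eq_one {z w : ℂ} (h : z * w = 1) (k : ℕ) :
    gE w k * gE z (k + 1) = z ^ 2 * gE z k * gE w (k + 1) := by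
  induction k with
  | zero => simp [gE]
  | succ k ih =>
    rw [gE_add_two, gE_add_two]
    linear_combination ih + gE w (k + 1) * gE z (k + 1) *
      (-3 * (z * w + 1) - 4 * z) * h + gE z (k + 1) * gE w k * (z * w + 1) * h

theorem gNum_mul_gNum_of_mul_eq_one {z w : ℂ} (h : z * w = 1) (k : ℕ) :
    (3 * (z + w) - 2) * (gNum z k * gNum w k) =
      2 * (gNum z k * gDen w k + gNum w k * gDen z k) := by
  have hz : z ≠ 0 := left_ne_zero_of_mul_eq_one h
  have hw : w = z⁻¹ := eq_inv_of_mul_eq_one_right h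
  have hE := gE_mul_gE_succ_of_mul_eq_one h k
  simp only [gNum, gDen]
  generalize gE w k = e at *
  generalize gE w (k + 1) = e' at *
  generalize gE z (k + 1) = E' at *
  generalize gE z k = E at *
  have : (2 * w * (1 + w) * e) * ((1 - z) * E') =
      2 * w * (1 + w) * (1 - z) * (z ^ 2 * E * e') := by rw [← hE]; ring
  rw [mul_add (2 * w * (1 + w) * e), this]
  subst hw
  field_simp
  ring

open ComplexConjugate in
theorem integral_exp_pow_mul_conj_pow (s k : ℕ) :
    ∫ θ in (0 : ℝ)..2 * Real.pi,
      Complex.exp (θ * Complex.I) ^ s * conj (Complex.exp (θ * Complex.I)) ^ k =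
        if s = k then 2 * (Real.pi : ℂ) else 0 := by
  have e : ∀ θ : ℝ, Complex.exp (θ * Complex.I) ^ s *
      conj (Complex.exp (θ * Complex.I)) ^ k =
        Complex.exp ((((s : ℤ) - k : ℤ) * Complex.I) * θ) := by
    intro θ
    rw [← Complex.exp_conj, ← Complex.exp_nat_mul, ← Complex.exp_nat_mul, ← Complex.exp_add]
    congr 1
    simp only [map_mul, Complex.conj_ofReal, Complex.conj_I]
    push_cast
    ring
  simp only [e]
  split_ifs with h
  · simp [h]
  · have hne : (((s : ℤ) - k : ℤ) * Complex.I : ℂ) ≠ 0 := by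
      refine mul_ne_zero (Int.cast_ne_zero.2 ?_) Complex.I_ne_zero
      omega
    rw [integral_exp_mul_complex hne]
    have : Complex.exp ((((s : ℤ) - k : ℤ) * Complex.I) * ((2 * Real.pi : ℝ) : ℂ)) = 1 := by
      rw [← Complex.exp_int_mul_two_pi_mul_I ((s : ℤ) - k)]
      congr 1
      push_cast
      ring
    rw [this]
    simp

theorem hasSum_mul_intervalIntegral {d : ℕ → ℂ} (hd : Summable fun i => ‖d i‖)
    {F : ℕ → ℝ → ℂ} (hF : ∀ i, Continuous (F i)) {B : ℝ} (hB : ∀ i θ, ‖F i θ‖ ≤ B) (a b : ℝ) :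
    HasSum (fun i => d i * ∫ θ in a..b, F i θ) (∫ θ in a..b, ∑' i, d i * F i θ) := by
  simp only [← intervalIntegral.integral_const_mul]
  have hle : ∀ i θ, ‖d i * F i θ‖ ≤ ‖d i‖ * B := fun i θ => by
    rw [norm_mul]
    exact mul_le_mul_of_nonneg_left (hB i θ) (norm_nonneg _)
  refine intervalIntegral.hasSum_integral_of_dominated_convergence (fun i _ => ‖d i‖ * B)
    (fun i => ((continuous_const.mul (hF i)).aestronglyMeasurable)) ?_ ?_ ?_ ?_
  · exact fun i => Eventually.of_forall fun θ _ => hle i θ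
  · exact Eventually.of_forall fun θ _ => hd.mul_right B
  · exact intervalIntegrable_const
  · exact Eventually.of_forall fun θ _ =>
      (Summable.of_norm_bounded (hd.mul_right B) fun i => hle i θ).hasSum

open ComplexConjugate in
/-- If `f(z) = ∑ cₜ zᵗ` has summable real coefficients, `c₀ = 0`, and
`(3 cos θ - 1) |f|² = 2 Re f` on the unit circle, then at the points `ζ` of the circle with
`cos θ = 1/3` the value of `f` is determined by `∑ cₜ²`. -/
theorem two_mul_tsum_eq_of_circle_identity {c : ℕ → ℝ} (hc : Summable fun t => ‖(c t : ℂ)‖)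
    (hc0 : c 0 = 0)
    (hf : ∀ z : ℂ, ‖z‖ = 1 →
      (3 * (z + conj z) - 2) * ((∑' t, (c t : ℂ) * z ^ t) * ∑' t, (c t : ℂ) * conj z ^ t) =
        2 * ((∑' t, (c t : ℂ) * z ^ t) + ∑' t, (c t : ℂ) * conj z ^ t))
    {ζ : ℂ} (hζ : ‖ζ‖ = 1) (hq : 3 * ζ ^ 2 - 2 * ζ + 3 = 0) :
    2 * ζ * ∑' t, (c t : ℂ) * ζ ^ t = (ζ - 3) * ((∑' t, c t ^ 2 : ℝ) : ℂ) := by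
  set e : ℝ → ℂ := fun θ => Complex.exp (θ * Complex.I) with he
  set w : ℝ → ℂ := fun θ => conj (e θ) with hw
  have hen : ∀ θ, ‖e θ‖ = 1 := fun θ => Complex.norm_exp_ofReal_mul_I θ
  have hwn : ∀ θ, ‖w θ‖ = 1 := fun θ => by rw [hw, Complex.norm_conj, hen]
  have hew : ∀ θ, e θ * w θ = 1 := fun θ => by
    rw [hw, Complex.mul_conj, Complex.normSq_eq_norm_sq, hen]; simp
  have hec : Continuous e := by fun_prop
  have hwc : Continuous w := Complex.continuous_conj.comp hec
  have horth : ∀ s k : ℕ, ∫ θ in (0 : ℝ)..2 * Real.pi, e θ ^ s * w θ ^ k =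
      if s = k then 2 * (Real.pi : ℂ) else 0 := integral_exp_pow_mul_conj_pow
  have hbound : ∀ z : ℂ, ‖z‖ = 1 → ∀ t, ‖(c t : ℂ) * z ^ t‖ = ‖(c t : ℂ)‖ := fun z hz t => by
    rw [norm_mul, norm_pow, hz, one_pow, mul_one]
  set f : ℝ → ℂ := fun θ => ∑' t, (c t : ℂ) * e θ ^ t with hfdef
  set g : ℝ → ℂ := fun θ => ∑' t, (c t : ℂ) * w θ ^ t with hgdef
  have hfc : Continuous f := continuous_tsum (fun t => by fun_prop) hc
    fun t θ => (hbound _ (hen θ) t).le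
  have hgc : Continuous g := continuous_tsum (fun t => by fun_prop) hc
    fun t θ => (hbound _ (hwn θ) t).le
  have hfb : ∀ θ, ‖f θ‖ ≤ ∑' t, ‖(c t : ℂ)‖ := fun θ =>
    tsum_of_norm_bounded hc.hasSum fun t => (hbound _ (hen θ) t).le
  have hgb : ∀ θ, ‖g θ‖ ≤ ∑' t, ‖(c t : ℂ)‖ := fun θ =>
    tsum_of_norm_bounded hc.hasSum fun t => (hbound _ (hwn θ) t).le
  have Mf : ∀ k : ℕ, ∫ θ in (0 : ℝ)..2 * Real.pi, f θ * w θ ^ k = 2 * Real.pi * c k := by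
    intro k
    have h := hasSum_mul_intervalIntegral hc (F := fun t θ => e θ ^ t * w θ ^ k) (B := 1)
      (fun t => by fun_prop) (fun t θ => by simp [hen, hwn]) 0 (2 * Real.pi)
    simp only [horth, ← mul_assoc, tsum_mul_right] at h
    rw [← h.tsum_eq, tsum_eq_single k fun t ht => by simp [ht]]
    simp [mul_comm]
  have Mg : ∀ s : ℕ, ∫ θ in (0 : ℝ)..2 * Real.pi, e θ ^ s * g θ = 2 * Real.pi * c s := by
    intro s
    have h := hasSum_mul_intervalIntegral hc (F := fun t θ => e θ ^ s * w θ ^ t) (B := 1)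
      (fun t => by fun_prop) (fun t θ => by simp [hen, hwn]) 0 (2 * Real.pi)
    simp only [horth, mul_left_comm (_ : ℂ) (_ ^ s), tsum_mul_left] at h
    rw [← h.tsum_eq, tsum_eq_single s fun t ht => by simp [ht.symm]]
    simp [mul_comm]
  have Mg' : ∀ k : ℕ, ∫ θ in (0 : ℝ)..2 * Real.pi, g θ * w θ ^ k = 0 := by
    intro k
    have h := hasSum_mul_intervalIntegral hc (F := fun t θ => e θ ^ 0 * w θ ^ (t + k)) (B := 1)
      (fun t => by fun_prop) (fun t θ => by simp [hwn]) 0 (2 * Real.pi)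
    simp only [horth] at h
    simp only [pow_zero, one_mul, pow_add, ← mul_assoc, tsum_mul_right] at h
    rw [← h.tsum_eq]
    refine (tsum_congr fun t => ?_).trans tsum_zero
    cases t with
    | zero => simp [hc0]
    | succ t => rw [if_neg (by omega), mul_zero]
  set A : ℕ → ℂ := fun k => ∑' s, (c s : ℂ) * c (s + k) with hA
  have MA : ∀ k : ℕ, ∫ θ in (0 : ℝ)..2 * Real.pi, f θ * g θ * w θ ^ k = 2 * Real.pi * A k := by
    intro k
    have h := hasSum_mul_intervalIntegral hc (F := fun s θ => f θ * w θ ^ (s + k))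
      (fun s => by fun_prop) (fun s θ => by simpa [hwn] using hfb θ) 0 (2 * Real.pi)
    simp only [Mf] at h
    rw [hA, ← tsum_mul_left]
    refine (Eq.trans ?_ h.tsum_eq.symm).trans (tsum_congr fun s => by ring)
    refine intervalIntegral.integral_congr fun θ _ => ?_
    simp only [hgdef]
    rw [mul_comm (f θ), mul_assoc, ← tsum_mul_right]
    exact tsum_congr fun s => by ring
  have MA' : ∫ θ in (0 : ℝ)..2 * Real.pi, f θ * g θ * e θ = 2 * Real.pi * A 1 := by
    have h := hasSum_mul_intervalIntegral hc (F := fun s θ => e θ ^ (s + 1) * g θ)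
      (fun s => by fun_prop) (fun s θ => by simpa [hen] using hgb θ) 0 (2 * Real.pi)
    simp only [Mg] at h
    rw [hA, ← tsum_mul_left]
    refine (Eq.trans ?_ h.tsum_eq.symm).trans (tsum_congr fun s => by ring)
    refine intervalIntegral.integral_congr fun θ _ => ?_
    simp only [hfdef]
    rw [mul_assoc, ← tsum_mul_right]
    exact tsum_congr fun s => by ring
  have hpi : (2 * Real.pi : ℂ) ≠ 0 := by simp [Real.pi_ne_zero]
  have hint : ∀ {h : ℝ → ℂ}, Continuous h →
      IntervalIntegrable h MeasureTheory.volume 0 (2 * Real.pi) :=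
    fun h => h.intervalIntegrable _ _
  have rec0 : 3 * A 1 = A 0 := by
    have h : ∀ θ, 3 * (f θ * g θ * e θ) + 3 * (f θ * g θ * w θ ^ 1) - 2 * (f θ * g θ * w θ ^ 0) =
        2 * (f θ * w θ ^ 0) + 2 * (g θ * w θ ^ 0) := fun θ => by
      linear_combination hf (e θ) (hen θ)
    have h2 := congrArg (fun F : ℝ → ℂ => ∫ θ in (0 : ℝ)..2 * Real.pi, F θ) (funext h)
    rw [intervalIntegral.integral_sub (hint (by fun_prop)) (hint (by fun_prop)),
      intervalIntegral.integral_add (hint (by fun_prop)) (hint (by fun_prop)),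
      intervalIntegral.integral_add (hint (by fun_prop)) (hint (by fun_prop))] at h2
    simp only [intervalIntegral.integral_const_mul, MA, MA', Mf, Mg', hc0] at h2
    apply mul_left_cancel₀ hpi
    push_cast at h2
    linear_combination h2 / 2
  have recs : ∀ k, 3 * A k + 3 * A (k + 2) - 2 * A (k + 1) = 2 * c (k + 1) := by
    intro k
    have h : ∀ θ, 3 * (f θ * g θ * w θ ^ k) + 3 * (f θ * g θ * w θ ^ (k + 2)) -
        2 * (f θ * g θ * w θ ^ (k + 1)) =
        2 * (f θ * w θ ^ (k + 1)) + 2 * (g θ * w θ ^ (k + 1)) := fun θ => by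
      linear_combination w θ ^ (k + 1) * hf (e θ) (hen θ) -
        3 * (f θ * g θ * w θ ^ k) * hew θ
    have h2 := congrArg (fun F : ℝ → ℂ => ∫ θ in (0 : ℝ)..2 * Real.pi, F θ) (funext h)
    rw [intervalIntegral.integral_sub (hint (by fun_prop)) (hint (by fun_prop)),
      intervalIntegral.integral_add (hint (by fun_prop)) (hint (by fun_prop)),
      intervalIntegral.integral_add (hint (by fun_prop)) (hint (by fun_prop))] at h2
    simp only [intervalIntegral.integral_const_mul, MA, Mf, Mg'] at h2
    apply mul_left_cancel₀ hpi
    linear_combination h2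
  have hAsum : Summable fun k => A k * ζ ^ k := by
    have hprod : Summable fun p : ℕ × ℕ => ‖(c p.1 : ℂ)‖ * ‖(c p.2 : ℂ)‖ :=
      hc.mul_of_nonneg hc (fun _ => norm_nonneg _) fun _ => norm_nonneg _
    have hinj : Function.Injective fun p : ℕ × ℕ => (p.2, p.2 + p.1) := by
      rintro ⟨a, b⟩ ⟨a', b'⟩ h
      simp only [Prod.mk.injEq] at h ⊢
      omega
    have hcomp := hprod.comp_injective hinj
    refine Summable.of_norm_bounded hcomp.prod fun k => ?_
    rw [norm_mul, norm_pow, hζ, one_pow, mul_one]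
    refine tsum_of_norm_bounded (hcomp.prod_factor k).hasSum fun s => ?_
    simp
  have hcsum : Summable fun t => (c t : ℂ) * ζ ^ t :=
    Summable.of_norm_bounded hc fun t => (hbound ζ hζ t).le
  have hA0 : A 0 = ((∑' t, c t ^ 2 : ℝ) : ℂ) := by
    rw [Complex.ofReal_tsum]
    exact tsum_congr fun t => by simp [pow_two]
  have s1 : Summable fun k => A (k + 1) * ζ ^ (k + 1) :=
    (summable_nat_add_iff (f := fun k => A k * ζ ^ k) 1).2 hAsum
  have s2 : Summable fun k => A (k + 2) * ζ ^ (k + 2) :=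
    (summable_nat_add_iff (f := fun k => A k * ζ ^ k) 2).2 hAsum
  have t1 := hAsum.tsum_eq_zero_add
  have t2 := s1.tsum_eq_zero_add
  have tc := hcsum.tsum_eq_zero_add
  have total : 2 * ζ * ∑' t, (c (t + 1) : ℂ) * ζ ^ (t + 1) =
      3 * ζ ^ 2 * ∑' k, A k * ζ ^ k + 3 * ∑' k, A (k + 2) * ζ ^ (k + 2) -
        2 * ζ * ∑' k, A (k + 1) * ζ ^ (k + 1) := by
    rw [← tsum_mul_left, ← tsum_mul_left, ← tsum_mul_left, ← tsum_mul_left,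
      ← (hAsum.mul_left _).tsum_add (s2.mul_left _),
      ← ((hAsum.mul_left _).add (s2.mul_left _)).tsum_sub (s1.mul_left _)]
    refine tsum_congr fun k => ?_
    linear_combination -ζ ^ (k + 2) * recs k
  rw [tc, hc0, ← hA0]
  simp only [zero_add, pow_zero, pow_one, mul_one] at t1 t2 ⊢
  push_cast
  rw [zero_add, total]
  linear_combination (-ζ) * rec0 + (∑' k, A k * ζ ^ k) * hq + (2 * ζ - 3) * t1 - 3 * t2

theorem gGen_one_mul_gDen (k : ℕ) :
    gGen (k + 1 : ℕ) 1 0 * gDen PowerSeries.X k = gNum PowerSeries.X k := by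
  have h := gGen_mul_gDen (n := (k + 1 : ℕ)) k (by omega)
  have e : ((k + 1 : ℕ) : ℤ) - k = 1 := by push_cast; ring
  rw [e, sub_self, gGen_boundary (m := 0) (by simp)] at h
  simpa using h

theorem gGen_one_mul_polynomial (k : ℕ) :
    gGen (k + 1 : ℕ) 1 0 * ((gDen Polynomial.X k : Polynomial ℂ) : PowerSeries ℂ) =
      ((gNum Polynomial.X k : Polynomial ℂ) : PowerSeries ℂ) := by
  rw [← Polynomial.coeToPowerSeries.ringHom_apply, ← Polynomial.coeToPowerSeries.ringHom_apply,
    map_gDen, map_gNum]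
  simpa using gGen_one_mul_gDen k

theorem eval_gDen_X (z : ℂ) (k : ℕ) : (gDen (Polynomial.X : Polynomial ℂ) k).eval z = gDen z k := by
  simpa using map_gDen (Polynomial.evalRingHom z) Polynomial.X k

theorem eval_gNum_X (z : ℂ) (k : ℕ) : (gNum (Polynomial.X : Polynomial ℂ) k).eval z = gNum z k := by
  simpa using map_gNum (Polynomial.evalRingHom z) Polynomial.X k

theorem coeff_gGen_one (n t : ℕ) :
    PowerSeries.coeff t (gGen n 1 0) = ((gcFin n 1 t : ℝ) : ℂ) := by
  rw [gcFin_eq_gW]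
  simp [gGen]

theorem summable_norm_gcFin (k : ℕ) : Summable fun t => ‖((gcFin (k + 2) 1 t : ℝ) : ℂ)‖ := by
  simp only [← coeff_gGen_one]
  refine summable_norm_coeff_of_mul_polynomial (fun z hz => ?_) (gGen_one_mul_polynomial (k + 1))
  rw [eval_gDen_X]
  exact gDen_ne_zero hz k

theorem tsum_gcFin_mul_gDen (k : ℕ) {z : ℂ} (hz : ‖z‖ ≤ 1) :
    (∑' t, ((gcFin (k + 2) 1 t : ℝ) : ℂ) * z ^ t) * gDen z (k + 1) = gNum z (k + 1) := by
  have hs := summable_norm_gcFin k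
  simp only [← coeff_gGen_one] at hs ⊢
  rw [← eval_gDen_X, ← eval_gNum_X]
  exact tsum_coeff_mul_eval hs (gGen_one_mul_polynomial (k + 1)) hz

open ComplexConjugate in
theorem two_mul_tsum_gcFin (k : ℕ) {ζ : ℂ} (hζ : ‖ζ‖ = 1) (hq : 3 * ζ ^ 2 - 2 * ζ + 3 = 0) :
    2 * ζ * ∑' t, ((gcFin (k + 2) 1 t : ℝ) : ℂ) * ζ ^ t = (ζ - 3) * (GPfin (k + 2) 1 : ℂ) := by
  refine two_mul_tsum_eq_of_circle_identity (summable_norm_gcFin k) ?_ (fun z hz => ?_) hζ hq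
  · rw [gcFin_eq_gW, gW_zero]
    simp
  · have hw : ‖conj z‖ = 1 := by rw [Complex.norm_conj, hz]
    have hzw : z * conj z = 1 := by
      rw [Complex.mul_conj, Complex.normSq_eq_norm_sq, hz]; simp
    have h1 := tsum_gcFin_mul_gDen k hz.le
    have h2 := tsum_gcFin_mul_gDen k hw.le
    have h := gNum_mul_gNum_of_mul_eq_one hzw (k + 1)
    rw [← h1, ← h2] at h
    apply mul_right_cancel₀ (mul_ne_zero (gDen_ne_zero hz.le k) (gDen_ne_zero hw.le k))
    linear_combination h

theorem finite_absorption_grover_fractional_recurrence (n : ℕ) (hn : 2 ≤ n) :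
    GPfin (n + 1) 1 = (2 + 3 * GPfin n 1) / (3 + 4 * GPfin n 1) := by
  obtain ⟨k, rfl⟩ := Nat.exists_eq_add_of_le' hn
  have hP : 0 ≤ GPfin (k + 2) 1 := tsum_nonneg fun _ => sq_nonneg _
  rw [eq_div_iff (by positivity)]
  obtain ⟨ζ, hζ, hq⟩ : ∃ ζ : ℂ, ‖ζ‖ = 1 ∧ 3 * ζ ^ 2 - 2 * ζ + 3 = 0 := by
    have h2 : (√2 : ℝ) ^ 2 = 2 := Real.sq_sqrt (by norm_num)
    refine ⟨⟨1 / 3, 2 * √2 / 3⟩, ?_, ?_⟩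
    · rw [← sq_eq_sq₀ (norm_nonneg _) zero_le_one, ← Complex.normSq_eq_norm_sq,
        Complex.normSq_mk]
      linear_combination 4 / 9 * h2
    · apply Complex.ext
      · simp [pow_two]
        linear_combination (-4 / 3) * h2
      · simp [pow_two]
        ring
  have hD := gDen_ne_zero hζ.le k
  have f0 := tsum_gcFin_mul_gDen k hζ.le
  have f1 := tsum_gcFin_mul_gDen (k + 1) hζ.le
  have e0 := two_mul_tsum_gcFin k hζ hq
  have e1 := two_mul_tsum_gcFin (k + 1) hζ hq
  have d := one_sub_mul_gDen_succ ζ (k + 1)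
  have u := one_sub_mul_gNum_succ ζ (k + 1)
  generalize (∑' t, ((gcFin (k + 2) 1 t : ℝ) : ℂ) * ζ ^ t) = f at *
  generalize (∑' t, ((gcFin (k + 1 + 2) 1 t : ℝ) : ℂ) * ζ ^ t) = f' at *
  rw [← f0] at d u
  have hm : f' * ((3 + ζ) - 2 * ζ * (1 + ζ) * f) =
      2 * ζ * (1 + ζ) - ζ ^ 2 * (1 + 3 * ζ) * f := by
    apply mul_right_cancel₀ hD
    linear_combination (1 - ζ) * f1 - f' * d + u
  rw [show k + 2 + 1 = k + 1 + 2 from rfl]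
  generalize GPfin (k + 1 + 2) 1 = P' at *
  generalize GPfin (k + 2) 1 = P at *
  have hne : (ζ - 3) * (ζ + 3) ≠ 0 := by
    refine mul_ne_zero (fun h => ?_) fun h => ?_
    · rw [sub_eq_zero.1 h] at hζ; norm_num at hζ
    · rw [eq_neg_of_add_eq_zero_left h] at hζ; norm_num at hζ
  have : (P' : ℂ) * (3 + 4 * P) = 2 + 3 * P := by
    apply mul_left_cancel₀ hne
    have h : (ζ - 3) * P' * ((3 + ζ) - (1 + ζ) * ((ζ - 3) * P)) =
        4 * ζ ^ 2 * (1 + ζ) - ζ ^ 2 * (1 + 3 * ζ) * ((ζ - 3) * P) := by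
      linear_combination 2 * ζ * hm - ((3 + ζ) - (1 + ζ) * ((ζ - 3) * P)) * e1 +
        2 * ζ * f' * (1 + ζ) * e0 - ζ ^ 2 * (1 + 3 * ζ) * e0
    linear_combination 3 * h +
      ((ζ - 3) * P' * P + 4 * ζ + 6 + 3 * P * (-ζ ^ 2 + 2 * ζ + 3)) * hq
  exact_mod_cast this
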